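/- arXiv:math/0002244 — 2 statements merged into one kernel-verified Lean document; each statement's English description precedes it below -/
import Mathlib

section
/- Suppose T and U are skew tableaux with at most l columns and entries from the alphabet [k]. Then U is Knuth-equivalent to T if and only if U^C is Knuth-equivalent to T^C, where both complements are formed with the same parameters k and l. -/
/-- A partition: weakly decreasing, eventually zero. -/
def IsPartition (f : ℕ → ℕ) : Prop :=
  (∀ i, f (i + 1) ≤ f i) ∧ ∃ N, ∀ i, N ≤ i → f i = 0

/-- `b/a` is a horizontal strip. -/
def HStrip (a b : ℕ → ℕ) : Prop :=
  (∀ i, a i ≤ b i) ∧ (∀ i, b (i + 1) ≤ a i)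

/-- A tableau with entries from `[k]`, as a chain of partitions. -/
def IsTableau (k : ℕ) (T : ℕ → ℕ → ℕ) : Prop :=
  (∀ i, i ≤ k → IsPartition (T i)) ∧ ∀ i, i < k → HStrip (T i) (T (i + 1))

/-- The complement of a tableau with parameters `k` and `l`. -/
def comp (k l : ℕ) (T : ℕ → ℕ → ℕ) : ℕ → ℕ → ℕ :=
  fun i j => if j < i then l else T (k - i) (j - i)

/-- The (row) reading word of the tableau `T` (a chain with entries from `[k]`,
whose shapes are contained in the first `n` rows): rows are read from bottom to top,
each row from left to right; the entry in a cell is the least `i` with `c < T i r`. -/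
def tabWord (k n : ℕ) (T : ℕ → ℕ → ℕ) : List ℕ :=
  ((List.range n).reverse).flatMap fun r =>
    (List.range (T k r)).filterMap fun c =>
      if T 0 r ≤ c then (List.range (k + 1)).find? (fun i => decide (c < T i r))
      else none

/-- Elementary Knuth transformations on words. -/
inductive KnuthStep : List ℕ → List ℕ → Prop
  | xzy (u v : List ℕ) (x y z : ℕ) (h1 : x ≤ y) (h2 : y < z) :
      KnuthStep (u ++ x :: z :: y :: v) (u ++ z :: x :: y :: v)
  | yxz (u v : List ℕ) (x y z : ℕ) (h1 : x < y) (h2 : y ≤ z) :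
      KnuthStep (u ++ y :: x :: z :: v) (u ++ y :: z :: x :: v)

/-- Knuth equivalence of words. -/
def KnuthEquiv : List ℕ → List ℕ → Prop := Relation.EqvGen KnuthStep

/-- Product of the bicyclic monoid, encoding the cancellation of matched brackets. -/
def bracketMul (a b : ℕ × ℕ) : ℕ × ℕ := (a.1 + (b.1 - a.2), b.2 + (a.2 - b.1))

/-- Bracket type of a letter: `i` closes a bracket and `i + 1` opens one. -/
def letterBracket (i a : ℕ) : ℕ × ℕ :=
  if a = i then (1, 0) else if a = i + 1 then (0, 1) else (0, 0)

/-- The numbers of unmatched letters `i` and `i + 1` in a word. -/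
def bracket (i : ℕ) : List ℕ → ℕ × ℕ
  | [] => (0, 0)
  | a :: w => bracketMul (letterBracket i a) (bracket i w)

lemma bracketMul_assoc (a b c : ℕ × ℕ) :
    bracketMul (bracketMul a b) c = bracketMul a (bracketMul b c) := by
  ext <;> simp only [bracketMul] <;> omega

lemma bracket_append (i : ℕ) (u v : List ℕ) :
    bracket i (u ++ v) = bracketMul (bracket i u) (bracket i v) := by
  induction u with
  | nil => ext <;> simp [bracket, bracketMul]
  | cons a u ih => simp only [List.cons_append, bracket, ih, bracketMul_assoc]

/-- `Raise i w w'`: the word `w'` arises from `w` by the crystal operator that turns the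
leftmost unmatched `i + 1` into `i`. -/
def Raise (i : ℕ) (w w' : List ℕ) : Prop :=
  ∃ u v, w = u ++ (i + 1) :: v ∧ w' = u ++ i :: v ∧ (bracket i u).2 = 0 ∧ (bracket i v).1 = 0

namespace KnuthEquiv

lemma of_step {w x : List ℕ} (h : KnuthStep w x) : KnuthEquiv w x := Relation.EqvGen.rel _ _ h

lemma refl (w : List ℕ) : KnuthEquiv w w := Relation.EqvGen.refl _

lemma symm {w x : List ℕ} (h : KnuthEquiv w x) : KnuthEquiv x w := Relation.EqvGen.symm _ _ h

lemma trans {w x y : List ℕ} (h : KnuthEquiv w x) (h' : KnuthEquiv x y) : KnuthEquiv w y :=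
  Relation.EqvGen.trans _ _ _ h h'

lemma append_left (u : List ℕ) {w x : List ℕ} (h : KnuthEquiv w x) :
    KnuthEquiv (u ++ w) (u ++ x) := by
  induction h with
  | rel w x h =>
    refine of_step ?_
    cases h with
    | xzy u' v x y z h1 h2 => simpa using KnuthStep.xzy (u ++ u') v x y z h1 h2
    | yxz u' v x y z h1 h2 => simpa using KnuthStep.yxz (u ++ u') v x y z h1 h2
  | refl w => exact refl _
  | symm w x _ ih => exact ih.symm
  | trans w x y _ _ ih ih' => exact ih.trans ih'

lemma append_right (u : List ℕ) {w x : List ℕ} (h : KnuthEquiv w x) :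
    KnuthEquiv (w ++ u) (x ++ u) := by
  induction h with
  | rel w x h =>
    refine of_step ?_
    cases h with
    | xzy u' v x y z h1 h2 => simpa using KnuthStep.xzy u' (v ++ u) x y z h1 h2
    | yxz u' v x y z h1 h2 => simpa using KnuthStep.yxz u' (v ++ u) x y z h1 h2
  | refl w => exact refl _
  | symm w x _ ih => exact ih.symm
  | trans w x y _ _ ih ih' => exact ih.trans ih'

lemma cons (a : ℕ) {w x : List ℕ} (h : KnuthEquiv w x) : KnuthEquiv (a :: w) (a :: x) :=
  append_left [a] h

lemma perm {w x : List ℕ} (h : KnuthEquiv w x) : w.Perm x := by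
  induction h with
  | rel w x h =>
    cases h with
    | xzy u v x y z h1 h2 => exact (List.Perm.swap _ _ _).append_left u
    | yxz u v x y z h1 h2 => exact ((List.Perm.swap _ _ _).cons y).append_left u
  | refl w => exact .refl _
  | symm w x _ ih => exact ih.symm
  | trans w x y _ _ ih ih' => exact ih.trans ih'

end KnuthEquiv

lemma KnuthStep.bracket_eq (i : ℕ) {w x : List ℕ} (h : KnuthStep w x) :
    bracket i w = bracket i x := by
  cases h with
  | xzy u v x y z h1 h2 =>
    simp only [bracket_append, bracket]
    congr 1
    ext <;> simp only [letterBracket, bracketMul] <;> split_ifs <;> simp only <;> omega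
  | yxz u v x y z h1 h2 =>
    simp only [bracket_append, bracket]
    congr 1
    ext <;> simp only [letterBracket, bracketMul] <;> split_ifs <;> simp only <;> omega

lemma KnuthEquiv.bracket_eq (i : ℕ) {w x : List ℕ} (h : KnuthEquiv w x) :
    bracket i w = bracket i x := by
  induction h with
  | rel w x h => exact h.bracket_eq i
  | refl w => rfl
  | symm w x _ ih => exact ih.symm
  | trans w x y _ _ ih ih' => exact ih.trans ih'

lemma append_cons_eq_triple {u₀ v₀ u v : List ℕ} {a b c d : ℕ}
    (h : u ++ a :: b :: c :: v = u₀ ++ d :: v₀) :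
    (∃ m, u = u₀ ++ d :: m ∧ v₀ = m ++ a :: b :: c :: v) ∨
    (u₀ = u ∧ a = d ∧ v₀ = b :: c :: v) ∨
    (u₀ = u ++ [a] ∧ b = d ∧ v₀ = c :: v) ∨
    (u₀ = u ++ [a, b] ∧ c = d ∧ v₀ = v) ∨
    (∃ m, u₀ = u ++ a :: b :: c :: m ∧ v = m ++ d :: v₀) := by
  rcases List.append_eq_append_iff.1 h with ⟨m, rfl, h⟩ | ⟨m, rfl, h⟩
  · rcases m with _ | ⟨a', _ | ⟨b', _ | ⟨c', m⟩⟩⟩ <;> simp at h <;> grind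
  · rcases m with _ | ⟨d', m⟩ <;> simp at h <;> grind

/-- Changing an extremal unmatched letter (`i + 1` to `i`, or `i` to `i + 1`) is compatible with
elementary Knuth transformations. -/
lemma KnuthStep.exists_change {i d d' : ℕ} (hd : d = i + 1 ∧ d' = i ∨ d = i ∧ d' = i + 1)
    {w x u₀ v₀ : List ℕ} (h : KnuthStep w x ∨ KnuthStep x w) (hw : w = u₀ ++ d :: v₀)
    (hu : (bracket i u₀).2 = 0) (hv : (bracket i v₀).1 = 0) :
    ∃ u₁ v₁, x = u₁ ++ d :: v₁ ∧ (bracket i u₁).2 = 0 ∧ (bracket i v₁).1 = 0 ∧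
      KnuthEquiv (u₀ ++ d' :: v₀) (u₁ ++ d' :: v₁) := by
  rcases h with h | h
  · cases h with
    | xzy u v x y z h1 h2 =>
      obtain ⟨m, rfl, rfl⟩ | ⟨rfl, rfl, rfl⟩ | ⟨rfl, rfl, rfl⟩ | ⟨rfl, rfl, rfl⟩ |
          ⟨m, rfl, rfl⟩ := append_cons_eq_triple hw
      · refine ⟨u₀, m ++ z :: x :: y :: v, by simp, hu, ?_, ?_⟩
        · rw [← hv, (KnuthStep.xzy m v x y z h1 h2).bracket_eq i]
        · simpa using (KnuthEquiv.of_step (KnuthStep.xzy (u₀ ++ d' :: m) v x y z h1 h2))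
      · by_cases hs : d' = i + 1 ∧ y = i ∧ z = i + 1
        · obtain ⟨hs1, hs2, hs3⟩ := hs
          obtain rfl : x = y := by grind
          obtain rfl : d' = z := by grind
          exact ⟨u₀ ++ [d', x], v, by simp,
            by grind [bracket, letterBracket, bracketMul, bracket_append],
            by grind [bracket, letterBracket, bracketMul, bracket_append], by
              simpa using (KnuthEquiv.of_step (KnuthStep.yxz u₀ v x d' d'
                (by grind [bracket, letterBracket, bracketMul, bracket_append])
                (by grind [bracket, letterBracket, bracketMul, bracket_append]))).symm⟩
        · exact ⟨u₀ ++ [z], y :: v, by simp,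
            by grind [bracket, letterBracket, bracketMul, bracket_append],
            by grind [bracket, letterBracket, bracketMul, bracket_append], by
              simpa using (KnuthEquiv.of_step (KnuthStep.xzy u₀ v d' y z
                (by grind [bracket, letterBracket, bracketMul, bracket_append])
                (by grind [bracket, letterBracket, bracketMul, bracket_append])))⟩
      · exact ⟨u, x :: y :: v, by simp,
          by grind [bracket, letterBracket, bracketMul, bracket_append],
          by grind [bracket, letterBracket, bracketMul, bracket_append], by
            simpa using (KnuthEquiv.of_step (KnuthStep.xzy u v x y d'
              (by grind [bracket, letterBracket, bracketMul, bracket_append])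
              (by grind [bracket, letterBracket, bracketMul, bracket_append])))⟩
      · exact ⟨u ++ [z, x], v₀, by simp,
          by grind [bracket, letterBracket, bracketMul, bracket_append],
          by grind [bracket, letterBracket, bracketMul, bracket_append], by
            simpa using (KnuthEquiv.of_step (KnuthStep.xzy u v₀ x d' z
              (by grind [bracket, letterBracket, bracketMul, bracket_append])
              (by grind [bracket, letterBracket, bracketMul, bracket_append])))⟩
      · refine ⟨u ++ z :: x :: y :: m, v₀, by simp, ?_, hv, ?_⟩
        · rw [← hu, (KnuthStep.xzy u m x y z h1 h2).bracket_eq i]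
        · simpa using (KnuthEquiv.of_step (KnuthStep.xzy u (m ++ d' :: v₀) x y z h1 h2))
    | yxz u v x y z h1 h2 =>
      obtain ⟨m, rfl, rfl⟩ | ⟨rfl, rfl, rfl⟩ | ⟨rfl, rfl, rfl⟩ | ⟨rfl, rfl, rfl⟩ |
          ⟨m, rfl, rfl⟩ := append_cons_eq_triple hw
      · refine ⟨u₀, m ++ y :: z :: x :: v, by simp, hu, ?_, ?_⟩
        · rw [← hv, (KnuthStep.yxz m v x y z h1 h2).bracket_eq i]
        · simpa using (KnuthEquiv.of_step (KnuthStep.yxz (u₀ ++ d' :: m) v x y z h1 h2))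
      · exact ⟨u₀, z :: x :: v, by simp,
          by grind [bracket, letterBracket, bracketMul, bracket_append],
          by grind [bracket, letterBracket, bracketMul, bracket_append], by
            simpa using (KnuthEquiv.of_step (KnuthStep.yxz u₀ v x d' z
              (by grind [bracket, letterBracket, bracketMul, bracket_append])
              (by grind [bracket, letterBracket, bracketMul, bracket_append])))⟩
      · exact ⟨u ++ [y, z], v, by simp,
          by grind [bracket, letterBracket, bracketMul, bracket_append],
          by grind [bracket, letterBracket, bracketMul, bracket_append], by
            simpa using (KnuthEquiv.of_step (KnuthStep.yxz u v d' y z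
              (by grind [bracket, letterBracket, bracketMul, bracket_append])
              (by grind [bracket, letterBracket, bracketMul, bracket_append])))⟩
      · by_cases hs : d' = i ∧ x = i ∧ y = i + 1
        · obtain ⟨hs1, hs2, hs3⟩ := hs
          obtain rfl : y = z := by grind
          obtain rfl : d' = x := by grind
          exact ⟨u, y :: d' :: v₀, by simp,
            by grind [bracket, letterBracket, bracketMul, bracket_append],
            by grind [bracket, letterBracket, bracketMul, bracket_append], by
              simpa using (KnuthEquiv.of_step (KnuthStep.xzy u v₀ d' d' y
                (by grind [bracket, letterBracket, bracketMul, bracket_append])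
                (by grind [bracket, letterBracket, bracketMul, bracket_append]))).symm⟩
        · exact ⟨u ++ [y], x :: v₀, by simp,
            by grind [bracket, letterBracket, bracketMul, bracket_append],
            by grind [bracket, letterBracket, bracketMul, bracket_append], by
              simpa using (KnuthEquiv.of_step (KnuthStep.yxz u v₀ x y d'
                (by grind [bracket, letterBracket, bracketMul, bracket_append])
                (by grind [bracket, letterBracket, bracketMul, bracket_append])))⟩
      · refine ⟨u ++ y :: z :: x :: m, v₀, by simp, ?_, hv, ?_⟩
        · rw [← hu, (KnuthStep.yxz u m x y z h1 h2).bracket_eq i]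
        · simpa using (KnuthEquiv.of_step (KnuthStep.yxz u (m ++ d' :: v₀) x y z h1 h2))
  · cases h with
    | xzy u v x y z h1 h2 =>
      obtain ⟨m, rfl, rfl⟩ | ⟨rfl, rfl, rfl⟩ | ⟨rfl, rfl, rfl⟩ | ⟨rfl, rfl, rfl⟩ |
          ⟨m, rfl, rfl⟩ := append_cons_eq_triple hw
      · refine ⟨u₀, m ++ x :: z :: y :: v, by simp, hu, ?_, ?_⟩
        · rw [← hv, (KnuthStep.xzy m v x y z h1 h2).bracket_eq i]
        · simpa using (KnuthEquiv.of_step (KnuthStep.xzy (u₀ ++ d' :: m) v x y z h1 h2)).symm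
      · exact ⟨u₀ ++ [x], y :: v, by simp,
          by grind [bracket, letterBracket, bracketMul, bracket_append],
          by grind [bracket, letterBracket, bracketMul, bracket_append], by
            simpa using (KnuthEquiv.of_step (KnuthStep.xzy u₀ v x y d'
              (by grind [bracket, letterBracket, bracketMul, bracket_append])
              (by grind [bracket, letterBracket, bracketMul, bracket_append]))).symm⟩
      · exact ⟨u, z :: y :: v, by simp,
          by grind [bracket, letterBracket, bracketMul, bracket_append],
          by grind [bracket, letterBracket, bracketMul, bracket_append], by
            simpa using (KnuthEquiv.of_step (KnuthStep.xzy u v d' y z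
              (by grind [bracket, letterBracket, bracketMul, bracket_append])
              (by grind [bracket, letterBracket, bracketMul, bracket_append]))).symm⟩
      · by_cases hs : d' = i + 1 ∧ x = i ∧ z = i + 1
        · obtain ⟨hs1, hs2, hs3⟩ := hs
          obtain rfl : x = y := by grind
          obtain rfl : d' = z := by grind
          exact ⟨u, d' :: x :: v₀, by simp,
            by grind [bracket, letterBracket, bracketMul, bracket_append],
            by grind [bracket, letterBracket, bracketMul, bracket_append], by
              simpa using (KnuthEquiv.of_step (KnuthStep.yxz u v₀ x d' d'
                (by grind [bracket, letterBracket, bracketMul, bracket_append])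
                (by grind [bracket, letterBracket, bracketMul, bracket_append])))⟩
        · exact ⟨u ++ [x, z], v₀, by simp,
            by grind [bracket, letterBracket, bracketMul, bracket_append],
            by grind [bracket, letterBracket, bracketMul, bracket_append], by
              simpa using (KnuthEquiv.of_step (KnuthStep.xzy u v₀ x d' z
                (by grind [bracket, letterBracket, bracketMul, bracket_append])
                (by grind [bracket, letterBracket, bracketMul, bracket_append]))).symm⟩
      · refine ⟨u ++ x :: z :: y :: m, v₀, by simp, ?_, hv, ?_⟩
        · rw [← hu, (KnuthStep.xzy u m x y z h1 h2).bracket_eq i]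
        · simpa using (KnuthEquiv.of_step (KnuthStep.xzy u (m ++ d' :: v₀) x y z h1 h2)).symm
    | yxz u v x y z h1 h2 =>
      obtain ⟨m, rfl, rfl⟩ | ⟨rfl, rfl, rfl⟩ | ⟨rfl, rfl, rfl⟩ | ⟨rfl, rfl, rfl⟩ |
          ⟨m, rfl, rfl⟩ := append_cons_eq_triple hw
      · refine ⟨u₀, m ++ y :: x :: z :: v, by simp, hu, ?_, ?_⟩
        · rw [← hv, (KnuthStep.yxz m v x y z h1 h2).bracket_eq i]
        · simpa using (KnuthEquiv.of_step (KnuthStep.yxz (u₀ ++ d' :: m) v x y z h1 h2)).symm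
      · by_cases hs : d' = i ∧ x = i ∧ z = i + 1
        · obtain ⟨hs1, hs2, hs3⟩ := hs
          obtain rfl : y = z := by grind
          obtain rfl : d' = x := by grind
          exact ⟨u₀ ++ [y, d'], v, by simp,
            by grind [bracket, letterBracket, bracketMul, bracket_append],
            by grind [bracket, letterBracket, bracketMul, bracket_append], by
              simpa using (KnuthEquiv.of_step (KnuthStep.xzy u₀ v d' d' y
                (by grind [bracket, letterBracket, bracketMul, bracket_append])
                (by grind [bracket, letterBracket, bracketMul, bracket_append])))⟩
        · exact ⟨u₀, x :: z :: v, by simp,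
            by grind [bracket, letterBracket, bracketMul, bracket_append],
            by grind [bracket, letterBracket, bracketMul, bracket_append], by
              simpa using (KnuthEquiv.of_step (KnuthStep.yxz u₀ v x d' z
                (by grind [bracket, letterBracket, bracketMul, bracket_append])
                (by grind [bracket, letterBracket, bracketMul, bracket_append]))).symm⟩
      · exact ⟨u ++ [y, x], v, by simp,
          by grind [bracket, letterBracket, bracketMul, bracket_append],
          by grind [bracket, letterBracket, bracketMul, bracket_append], by
            simpa using (KnuthEquiv.of_step (KnuthStep.yxz u v x y d'
              (by grind [bracket, letterBracket, bracketMul, bracket_append])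
              (by grind [bracket, letterBracket, bracketMul, bracket_append]))).symm⟩
      · exact ⟨u ++ [y], z :: v₀, by simp,
          by grind [bracket, letterBracket, bracketMul, bracket_append],
          by grind [bracket, letterBracket, bracketMul, bracket_append], by
            simpa using (KnuthEquiv.of_step (KnuthStep.yxz u v₀ d' y z
              (by grind [bracket, letterBracket, bracketMul, bracket_append])
              (by grind [bracket, letterBracket, bracketMul, bracket_append]))).symm⟩
      · refine ⟨u ++ y :: x :: z :: m, v₀, by simp, ?_, hv, ?_⟩
        · rw [← hu, (KnuthStep.yxz u m x y z h1 h2).bracket_eq i]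
        · simpa using (KnuthEquiv.of_step (KnuthStep.yxz u (m ++ d' :: v₀) x y z h1 h2)).symm

/-- The letter changed by a crystal operator is determined by the word. -/
lemma append_cons_unmatched_inj {i d : ℕ} (hd : d = i + 1 ∨ d = i) {u v u' v' : List ℕ}
    (h : u ++ d :: v = u' ++ d :: v') (hu : (bracket i u).2 = 0) (hv : (bracket i v).1 = 0)
    (hu' : (bracket i u').2 = 0) (hv' : (bracket i v').1 = 0) : u = u' ∧ v = v' := by
  rcases List.append_eq_append_iff.1 h with ⟨m, rfl, h⟩ | ⟨m, rfl, h⟩ <;>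
  rcases m with _ | ⟨a, m⟩ <;> simp at h <;>
  grind [bracket, letterBracket, bracketMul, bracket_append]

lemma Raise.right_unique {i : ℕ} {w x y : List ℕ} (h : Raise i w x) (h' : Raise i w y) :
    x = y := by
  obtain ⟨u, v, rfl, rfl, hu, hv⟩ := h
  obtain ⟨u', v', h, rfl, hu', hv'⟩ := h'
  obtain ⟨rfl, rfl⟩ := append_cons_unmatched_inj (.inl rfl) h hu hv hu' hv'
  rfl

lemma Raise.left_unique {i : ℕ} {w x y : List ℕ} (h : Raise i x w) (h' : Raise i y w) :
    x = y := by
  obtain ⟨u, v, rfl, rfl, hu, hv⟩ := h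
  obtain ⟨u', v', rfl, h, hu', hv'⟩ := h'
  obtain ⟨rfl, rfl⟩ := append_cons_unmatched_inj (.inr rfl) h hu hv hu' hv'
  rfl

lemma Raise.bracket_pos {i : ℕ} {w x : List ℕ} (h : Raise i w x) : 0 < (bracket i w).2 := by
  obtain ⟨u, v, rfl, rfl, hu, hv⟩ := h
  grind [bracket, letterBracket, bracketMul, bracket_append]

lemma Raise.sum_lt {i : ℕ} {w x : List ℕ} (h : Raise i w x) : x.sum < w.sum := by
  obtain ⟨u, v, rfl, rfl, hu, hv⟩ := h
  simp

lemma KnuthEquiv.exists_change {i d d' : ℕ} (hd : d = i + 1 ∧ d' = i ∨ d = i ∧ d' = i + 1)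
    {w x : List ℕ} (h : KnuthEquiv w x) :
    (∀ u₀ v₀ : List ℕ, w = u₀ ++ d :: v₀ → (bracket i u₀).2 = 0 → (bracket i v₀).1 = 0 →
      ∃ u₁ v₁, x = u₁ ++ d :: v₁ ∧ (bracket i u₁).2 = 0 ∧ (bracket i v₁).1 = 0 ∧
        KnuthEquiv (u₀ ++ d' :: v₀) (u₁ ++ d' :: v₁)) ∧
    (∀ u₀ v₀ : List ℕ, x = u₀ ++ d :: v₀ → (bracket i u₀).2 = 0 → (bracket i v₀).1 = 0 →
      ∃ u₁ v₁, w = u₁ ++ d :: v₁ ∧ (bracket i u₁).2 = 0 ∧ (bracket i v₁).1 = 0 ∧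
        KnuthEquiv (u₀ ++ d' :: v₀) (u₁ ++ d' :: v₁)) := by
  induction h with
  | rel w x h =>
    exact ⟨fun _ _ => KnuthStep.exists_change hd (.inl h),
      fun _ _ => KnuthStep.exists_change hd (.inr h)⟩
  | refl w => exact ⟨fun u v h hu hv => ⟨u, v, h, hu, hv, .refl _⟩,
      fun u v h hu hv => ⟨u, v, h, hu, hv, .refl _⟩⟩
  | symm w x _ ih => exact ih.symm
  | trans w x y _ _ ih ih' =>
    constructor
    · intro u v h hu hv
      obtain ⟨u, v, h, hu, hv, e⟩ := ih.1 u v h hu hv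
      obtain ⟨u, v, h, hu, hv, e'⟩ := ih'.1 u v h hu hv
      exact ⟨u, v, h, hu, hv, e.trans e'⟩
    · intro u v h hu hv
      obtain ⟨u, v, h, hu, hv, e⟩ := ih'.2 u v h hu hv
      obtain ⟨u, v, h, hu, hv, e'⟩ := ih.2 u v h hu hv
      exact ⟨u, v, h, hu, hv, e.trans e'⟩

lemma Raise.knuthEquiv_iff {i : ℕ} {w x w' x' : List ℕ} (hw : Raise i w w') (hx : Raise i x x') :
    KnuthEquiv w x ↔ KnuthEquiv w' x' := by
  constructor <;> intro h
  · obtain ⟨u, v, rfl, rfl, hu, hv⟩ := hw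
    obtain ⟨u', v', rfl, hu', hv', e⟩ := (h.exists_change (.inl ⟨rfl, rfl⟩)).1 u v rfl hu hv
    rwa [hx.right_unique ⟨u', v', rfl, rfl, hu', hv'⟩]
  · obtain ⟨u, v, rfl, rfl, hu, hv⟩ := hw
    obtain ⟨u', v', rfl, hu', hv', e⟩ := (h.exists_change (.inr ⟨rfl, rfl⟩)).1 u v rfl hu hv
    rw [hx.left_unique ⟨u', v', rfl, rfl, hu', hv'⟩]
    exact e

/-- The column word `h (h - 1) ⋯ 1`. -/
def columnWord : ℕ → List ℕ
  | 0 => []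
  | h + 1 => (h + 1) :: columnWord h

lemma columnWord_insert_comm (h z : ℕ) (hz : h + 1 ≤ z) :
    KnuthEquiv ((h + 1) :: z :: columnWord h) (columnWord (h + 1) ++ [z]) := by
  induction h with
  | zero => exact .refl _
  | succ h ih =>
    refine (KnuthEquiv.of_step (KnuthStep.yxz [] (columnWord h) (h + 1) (h + 2) z
      (by omega) hz)).symm.trans ?_
    exact (ih (by omega)).cons (h + 2)

lemma columnWord_letter_comm {a h : ℕ} (ha : 1 ≤ a) (hah : a ≤ h) :
    KnuthEquiv (a :: columnWord h) (columnWord h ++ [a]) := by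
  induction h with
  | zero => omega
  | succ h ih =>
    rcases hah.eq_or_lt with rfl | hlt
    · exact columnWord_insert_comm h (h + 1) le_rfl
    · obtain ⟨g, rfl⟩ : ∃ g, h = g + 1 := ⟨h - 1, by omega⟩
      refine (KnuthEquiv.of_step (KnuthStep.xzy [] (columnWord g) a (g + 1) (g + 2)
        (by omega) (by omega))).trans ?_
      exact (ih (by omega)).cons (g + 2)

lemma columnWord_comm_of_le {g h : ℕ} (hgh : g ≤ h) :
    KnuthEquiv (columnWord g ++ columnWord h) (columnWord h ++ columnWord g) := by
  induction g with
  | zero => simpa [columnWord] using KnuthEquiv.refl _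
  | succ g ih =>
    refine ((ih (by omega)).cons (g + 1)).trans ?_
    simpa [columnWord] using
      (columnWord_letter_comm (by omega) hgh).append_right (columnWord g)

lemma columnWord_comm (g h : ℕ) :
    KnuthEquiv (columnWord g ++ columnWord h) (columnWord h ++ columnWord g) := by
  rcases le_total g h with hgh | hgh
  · exact columnWord_comm_of_le hgh
  · exact (columnWord_comm_of_le hgh).symm

lemma knuthEquiv_flatMap_columnWord {L L' : List ℕ} (h : L.Perm L') :
    KnuthEquiv (L.flatMap columnWord) (L'.flatMap columnWord) := by
  induction h with
  | nil => exact .refl _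
  | cons a _ ih => simpa using ih.append_left (columnWord a)
  | swap a b L => simpa using (columnWord_comm b a).append_right (L.flatMap columnWord)
  | trans _ _ ih ih' => exact ih.trans ih'

lemma count_columnWord {i : ℕ} (hi : 1 ≤ i) (h : ℕ) :
    (columnWord h).count i = if i ≤ h then 1 else 0 := by
  induction h with
  | zero => simp [columnWord]; omega
  | succ h ih => simp only [columnWord, List.count_cons, ih, beq_iff_eq]; grind

lemma count_flatMap_columnWord {i : ℕ} (hi : 1 ≤ i) (L : List ℕ) :
    (L.flatMap columnWord).count i = L.countP (fun h => decide (i ≤ h)) := by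
  induction L with
  | nil => simp
  | cons h L ih =>
    simp [List.flatMap_cons, List.count_append, ih, count_columnWord hi, List.countP_cons, add_comm]

lemma count_add_countP (L : List ℕ) (i : ℕ) :
    L.count i + L.countP (fun h => decide (i + 1 ≤ h)) = L.countP (fun h => decide (i ≤ h)) := by
  induction L with
  | nil => simp
  | cons h L ih => simp only [List.count_cons, List.countP_cons, ← ih]; grind

lemma bracket_add_count (i : ℕ) (w : List ℕ) :
    (bracket i w).1 + w.count (i + 1) = (bracket i w).2 + w.count i := by
  induction w with
  | nil => simp [bracket]
  | cons a w ih =>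
    simp only [bracket, bracketMul, letterBracket, List.count_cons]
    grind

/-- A Yamanouchi word is Knuth-equivalent to a product of column words. -/
lemma exists_knuthEquiv_flatMap_columnWord {w : List ℕ} (h1 : ∀ a ∈ w, 1 ≤ a)
    (hw : ∀ i, 1 ≤ i → (bracket i w).2 = 0) :
    ∃ L : List ℕ, (∀ h ∈ L, 1 ≤ h) ∧ KnuthEquiv w (L.flatMap columnWord) := by
  induction w with
  | nil => exact ⟨[], by simp, .refl _⟩
  | cons a w ih =>
    have hw' : ∀ i, 1 ≤ i → (bracket i w).2 = 0 := fun i hi => by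
      have := hw i hi
      simp only [bracket, bracketMul] at this
      omega
    obtain ⟨L, hL, e⟩ := ih (fun b hb => h1 b (List.mem_cons_of_mem _ hb)) hw'
    obtain rfl | ⟨b, rfl⟩ : a = 1 ∨ ∃ b, a = b + 2 := by
      have := h1 a (by simp)
      rcases this.eq_or_lt with h | h
      · exact .inl h.symm
      · exact .inr ⟨a - 2, by omega⟩
    · exact ⟨1 :: L, by simpa using hL, e.cons 1⟩
    · have hb := hw (b + 1) (by omega)
      simp only [bracket, bracketMul, letterBracket] at hb
      have hc := bracket_add_count (b + 1) w
      rw [e.perm.count_eq, e.perm.count_eq, count_flatMap_columnWord (by omega),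
        count_flatMap_columnWord (by omega)] at hc
      have hd := count_add_countP L (b + 1)
      have hmem : b + 1 ∈ L := List.count_pos_iff.1 (by grind)
      refine ⟨(b + 2) :: L.erase (b + 1), ?_, ?_⟩
      · intro h hh
        rcases List.mem_cons.1 hh with rfl | hh
        · omega
        · exact hL h (List.mem_of_mem_erase hh)
      · refine (e.trans (knuthEquiv_flatMap_columnWord (List.perm_cons_erase hmem))).cons (b + 2)

/-- Yamanouchi words with the same content are Knuth-equivalent. -/
lemma knuthEquiv_of_bracket_eq_zero {w x : List ℕ} (hw1 : ∀ a ∈ w, 1 ≤ a) (hx1 : ∀ a ∈ x, 1 ≤ a)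
    (hw : ∀ i, 1 ≤ i → (bracket i w).2 = 0) (hx : ∀ i, 1 ≤ i → (bracket i x).2 = 0)
    (hc : ∀ i, w.count i = x.count i) : KnuthEquiv w x := by
  obtain ⟨L, hL, e⟩ := exists_knuthEquiv_flatMap_columnWord hw1 hw
  obtain ⟨M, hM, e'⟩ := exists_knuthEquiv_flatMap_columnWord hx1 hx
  refine e.trans ((knuthEquiv_flatMap_columnWord (List.perm_iff_count.2 fun i => ?_)).trans e'.symm)
  have key : ∀ j, 1 ≤ j →
      L.countP (fun h => decide (j ≤ h)) = M.countP (fun h => decide (j ≤ h)) := fun j hj => by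
    rw [← count_flatMap_columnWord hj, ← count_flatMap_columnWord hj, ← e.perm.count_eq,
      ← e'.perm.count_eq, hc]
  rcases Nat.eq_zero_or_pos i with rfl | hi
  · rw [List.count_eq_zero.2 fun h => absurd (hL 0 h) (by omega),
      List.count_eq_zero.2 fun h => absurd (hM 0 h) (by omega)]
  · have h1 := count_add_countP L i
    have h2 := count_add_countP M i
    rw [key i hi, key (i + 1) (by omega)] at h1
    omega

lemma bracket_snd_le_count (i : ℕ) (w : List ℕ) : (bracket i w).2 ≤ w.count (i + 1) := by
  induction w with
  | nil => simp [bracket]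
  | cons a w ih =>
    simp only [bracket, bracketMul, letterBracket, List.count_cons]
    grind

/-- A relation between words that intertwines the crystal operators with indices `i` and `k - i`,
and relates the contents, transports Knuth equivalence. -/
lemma KnuthEquiv.transport {k l : ℕ} {R : List ℕ → List ℕ → Prop}
    (hletter : ∀ w v, R w v → ∀ a ∈ v, 1 ≤ a ∧ a ≤ k)
    (hcount : ∀ w v, R w v → ∀ i, 1 ≤ i → i ≤ k → v.count i + w.count (k + 1 - i) = l)
    (hraise : ∀ w v, R w v → ∀ i, 1 ≤ i → i < k →
      ((bracket i w).2 = 0 ∧ (bracket (k - i) v).2 = 0) ∨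
      ∃ w' v', Raise i w w' ∧ Raise (k - i) v v' ∧ R w' v')
    {w v x y : List ℕ} (hwv : R w v) (hxy : R x y) (h : KnuthEquiv w x) : KnuthEquiv v y := by
  induction hs : w.sum using Nat.strong_induction_on generalizing w v x y with
  | _ s ih =>
  by_cases hz : ∀ i, 1 ≤ i → i < k → (bracket i w).2 = 0
  · have aux : ∀ w v, R w v → (∀ i, 1 ≤ i → i < k → (bracket i w).2 = 0) →
        ∀ i, 1 ≤ i → (bracket i v).2 = 0 := by
      intro w v hwv hz i hi
      rcases lt_or_ge i k with hik | hik
      · rcases hraise w v hwv (k - i) (by omega) (by omega) with h | ⟨w', v', hw', -, -⟩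
        · simpa [Nat.sub_sub_self hik.le] using h.2
        · have := hw'.bracket_pos
          have := hz (k - i) (by omega) (by omega)
          omega
      · have := bracket_snd_le_count i v
        rw [List.count_eq_zero.2 fun h => by have := hletter w v hwv _ h; omega] at this
        omega
    refine knuthEquiv_of_bracket_eq_zero (fun a ha => (hletter _ _ hwv a ha).1)
      (fun a ha => (hletter _ _ hxy a ha).1) (aux _ _ hwv hz)
      (aux _ _ hxy fun i hi hik => h.bracket_eq i ▸ hz i hi hik) fun i => ?_
    by_cases hi : 1 ≤ i ∧ i ≤ k
    · have h1 := hcount _ _ hwv i hi.1 hi.2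
      have h2 := hcount _ _ hxy i hi.1 hi.2
      rw [h.perm.count_eq] at h1
      omega
    · rw [List.count_eq_zero.2 fun h => hi (hletter _ _ hwv _ h),
        List.count_eq_zero.2 fun h => hi (hletter _ _ hxy _ h)]
  · push Not at hz
    obtain ⟨i, hi, hik, hne⟩ := hz
    have hne' : (bracket i x).2 ≠ 0 := h.bracket_eq i ▸ hne
    obtain ⟨w', v', hw', hv', hwv'⟩ := (hraise _ _ hwv i hi hik).resolve_left fun h => hne h.1
    obtain ⟨x', y', hx', hy', hxy'⟩ := (hraise _ _ hxy i hi hik).resolve_left fun h => hne' h.1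
    exact (hv'.knuthEquiv_iff hy').2
      (ih _ (hs ▸ hw'.sum_lt) hwv' hxy' ((hw'.knuthEquiv_iff hx').1 h) rfl)

/-- The part with entries in `(a, a + m]` of a row of a tableau; the cells with entry at most `j`
are those in columns below `t j`. -/
def rowSegment (t : ℕ → ℕ) (a m : ℕ) : List ℕ :=
  (List.range' a m).flatMap fun j => List.replicate (t (j + 1) - t j) (j + 1)

lemma rowSegment_add (t : ℕ → ℕ) (a m p : ℕ) :
    rowSegment t a (m + p) = rowSegment t a m ++ rowSegment t (a + m) p := by
  simp [rowSegment, ← List.range'_append_1]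

lemma rowSegment_one (t : ℕ → ℕ) (a : ℕ) :
    rowSegment t a 1 = List.replicate (t (a + 1) - t a) (a + 1) := by
  simp [rowSegment]

lemma rowSegment_congr {t t' : ℕ → ℕ} {a m : ℕ} (h : ∀ j, a ≤ j → j ≤ a + m → t j = t' j) :
    rowSegment t a m = rowSegment t' a m := by
  refine List.flatMap_congr fun j hj => ?_
  rw [List.mem_range'_1] at hj
  rw [h j (by omega) (by omega), h (j + 1) (by omega) (by omega)]

lemma mem_rowSegment {t : ℕ → ℕ} {a m x : ℕ} (h : x ∈ rowSegment t a m) : a < x ∧ x ≤ a + m := by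
  simp only [rowSegment, List.mem_flatMap, List.mem_range'_1, List.mem_replicate] at h
  omega

lemma bracket_eq_zero {i : ℕ} {w : List ℕ} (h : ∀ a ∈ w, a ≠ i ∧ a ≠ i + 1) :
    bracket i w = (0, 0) := by
  induction w with
  | nil => rfl
  | cons a w ih =>
    have := h a (by simp)
    simp [bracket, letterBracket, bracketMul, this, ih fun b hb => h b (List.mem_cons_of_mem _ hb)]

lemma bracket_replicate_self (i n : ℕ) : bracket i (List.replicate n i) = (n, 0) := by
  induction n with
  | zero => rfl
  | succ n ih => simp [List.replicate_succ, bracket, letterBracket, bracketMul, ih, add_comm]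

lemma bracket_replicate_succ (i n : ℕ) : bracket i (List.replicate n (i + 1)) = (0, n) := by
  induction n with
  | zero => rfl
  | succ n ih => simp [List.replicate_succ, bracket, letterBracket, bracketMul, ih]

lemma rowSegment_split {k i : ℕ} (hi : 1 ≤ i) (hik : i < k) (t : ℕ → ℕ) :
    rowSegment t 0 k = rowSegment t 0 (i - 1) ++ (List.replicate (t i - t (i - 1)) i ++
      (List.replicate (t (i + 1) - t i) (i + 1) ++ rowSegment t (i + 1) (k - i - 1))) := by
  obtain ⟨m, rfl⟩ : ∃ m, i = m + 1 := ⟨i - 1, by omega⟩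
  obtain ⟨p, rfl⟩ : ∃ p, k = m + (1 + (1 + p)) := ⟨k - m - 2, by omega⟩
  rw [rowSegment_add, rowSegment_add, rowSegment_add, rowSegment_one, rowSegment_one]
  have : m + (1 + (1 + p)) - (m + 1) - 1 = p := by omega
  simp [this]

lemma bracket_rowSegment_left {i m : ℕ} (hm : m < i) (t : ℕ → ℕ) :
    bracket i (rowSegment t 0 m) = (0, 0) :=
  bracket_eq_zero fun _ ha => by have := mem_rowSegment ha; omega

lemma bracket_rowSegment_right (i p : ℕ) (t : ℕ → ℕ) :
    bracket i (rowSegment t (i + 1) p) = (0, 0) :=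
  bracket_eq_zero fun _ ha => by have := mem_rowSegment ha; omega

lemma bracket_rowSegment {k i : ℕ} (hi : 1 ≤ i) (hik : i < k) (t : ℕ → ℕ) :
    bracket i (rowSegment t 0 k) = (t i - t (i - 1), t (i + 1) - t i) := by
  rw [rowSegment_split hi hik]
  simp [bracket_append, bracket_rowSegment_left (Nat.sub_lt hi one_pos), bracket_replicate_self,
    bracket_replicate_succ, bracket_rowSegment_right, bracketMul]

lemma le_of_forall_le_succ {k i : ℕ} {t : ℕ → ℕ} (ht : ∀ i, i < k → t i ≤ t (i + 1))
    (hi : i ≤ k) : t i ≤ t k := by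
  induction hi using Nat.decreasingInduction with
  | self => exact le_rfl
  | of_succ j hj ih => exact (ht j hj).trans ih

lemma filterMap_find?_eq_rowSegment {k : ℕ} {t : ℕ → ℕ} (ht : ∀ i, i < k → t i ≤ t (i + 1)) :
    ((List.range (t k)).filterMap fun c =>
      if t 0 ≤ c then (List.range (k + 1)).find? (fun i => decide (c < t i)) else none) =
      rowSegment t 0 k := by
  induction k with
  | zero =>
    simp only [rowSegment, List.range'_zero, List.flatMap_nil, List.filterMap_eq_nil_iff,
      List.mem_range]
    intro c hc
    rw [if_neg (by omega)]
  | succ k ih =>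
    have hmono : ∀ j, j ≤ k → t j ≤ t k := fun j hj =>
      le_of_forall_le_succ (fun i hi => ht i (by omega)) hj
    rw [rowSegment_add, rowSegment_one, zero_add, ← ih fun i hi => ht i (by omega)]
    obtain ⟨d, hd⟩ := Nat.exists_eq_add_of_le (ht k (by omega))
    rw [hd, List.range_add (n := t k), List.filterMap_append, Nat.add_sub_cancel_left]
    congr 1
    · refine List.filterMap_congr fun c hc => ?_
      rw [List.mem_range] at hc
      rw [List.range_succ (n := k + 1), List.find?_append]
      have : ((List.range (k + 1)).find? (fun i => decide (c < t i))).isSome := by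
        rw [List.find?_isSome]
        exact ⟨k, by simp, by simpa using hc⟩
      obtain ⟨b, hb⟩ := Option.isSome_iff_exists.1 this
      rw [hb]
      rfl
    · rw [List.filterMap_map]
      rw [List.filterMap_congr (g := fun _ => some (k + 1))]
      · simp [List.filterMap_eq_map', List.map_const']
      · intro c hc
        rw [List.mem_range] at hc
        have h0 := hmono 0 (by omega)
        rw [Function.comp_apply, if_pos (by omega), List.range_succ (n := k + 1), List.find?_append,
          List.find?_eq_none.2]
        · simp [hd, hc]
        · intro j hj
          rw [List.mem_range] at hj
          have := hmono j (by omega)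
          simp only [decide_eq_true_eq]
          omega

/-- The chain condition of a tableau, row by row. -/
def RowMonotone (k : ℕ) (T : ℕ → ℕ → ℕ) : Prop := ∀ r i, i < k → T i r ≤ T (i + 1) r

lemma tabWord_succ {k : ℕ} {T : ℕ → ℕ → ℕ} (hT : RowMonotone k T) (n : ℕ) :
    tabWord k (n + 1) T = rowSegment (fun i => T i n) 0 k ++ tabWord k n T := by
  rw [← filterMap_find?_eq_rowSegment (hT n)]
  simp [tabWord, List.range_succ]

lemma tabWord_congr {k n : ℕ} {T T' : ℕ → ℕ → ℕ} (h : ∀ r, r < n → ∀ i, T i r = T' i r) :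
    tabWord k n T = tabWord k n T' := by
  refine List.flatMap_congr fun r hr => ?_
  have hr' := h r (by simpa using hr)
  simp only [hr']

lemma mem_tabWord {k n a : ℕ} {T : ℕ → ℕ → ℕ} (hT : RowMonotone k T) (h : a ∈ tabWord k n T) :
    1 ≤ a ∧ a ≤ k := by
  induction n with
  | zero => simp [tabWord] at h
  | succ n ih =>
    rw [tabWord_succ hT, List.mem_append] at h
    rcases h with h | h
    · have := mem_rowSegment h
      omega
    · exact ih h

/-- Add one cell to row `r` of the `i`-th partition: the first entry `i + 1` of row `r`
becomes `i`. -/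
def raiseAt (i r : ℕ) (T : ℕ → ℕ → ℕ) : ℕ → ℕ → ℕ :=
  fun j s => if j = i ∧ s = r then T j s + 1 else T j s

lemma Raise.append_left {i : ℕ} {w w' u : List ℕ} (h : Raise i w w')
    (hu : (bracket i u).2 ≤ (bracket i w).1) : Raise i (u ++ w) (u ++ w') := by
  obtain ⟨s, v, rfl, rfl, hs, hv⟩ := h
  refine ⟨u ++ s, v, by simp, by simp, ?_, hv⟩
  simp only [bracket_append, bracket, letterBracket, bracketMul] at *
  grind

/-- The number of letters `i` that are unmatched among the rows above row `r`. -/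
def unmatchedAbove (k i : ℕ) (T : ℕ → ℕ → ℕ) (r : ℕ) : ℕ := (bracket i (tabWord k r T)).1

section

variable {k i : ℕ} {T : ℕ → ℕ → ℕ}

lemma unmatchedAbove_zero : unmatchedAbove k i T 0 = 0 := rfl

lemma unmatchedAbove_succ (hT : RowMonotone k T) (hi : 1 ≤ i) (hik : i < k) (r : ℕ) :
    unmatchedAbove k i T (r + 1) =
      T i r - T (i - 1) r + (unmatchedAbove k i T r - (T (i + 1) r - T i r)) := by
  simp [unmatchedAbove, tabWord_succ hT, bracket_append, bracket_rowSegment hi hik, bracketMul]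

lemma bracket_tabWord_eq_zero (hT : RowMonotone k T) (hi : 1 ≤ i) (hik : i < k) {n : ℕ}
    (h : ∀ r, r < n → T (i + 1) r - T i r ≤ unmatchedAbove k i T r) :
    (bracket i (tabWord k n T)).2 = 0 := by
  induction n with
  | zero => rfl
  | succ n ih =>
    have h1 := h n (by omega)
    have h2 := ih fun r hr => h r (by omega)
    simp only [tabWord_succ hT, bracket_append, bracket_rowSegment hi hik, bracketMul, h2]
    rw [unmatchedAbove] at h1
    omega

lemma RowMonotone.raiseAt (hT : RowMonotone k T) {r : ℕ} (hb : T i r < T (i + 1) r) :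
    RowMonotone k (raiseAt i r T) := by
  intro s j hj
  have := hT s j hj
  simp only [_root_.raiseAt]
  grind

lemma raise_rowSegment_append (hi : 1 ≤ i) (hik : i < k) {t t' : ℕ → ℕ} {w : List ℕ}
    (hm : t (i - 1) ≤ t i) (ht' : ∀ j, j ≠ i → t' j = t j) (hti : t' i = t i + 1)
    (hw : (bracket i w).1 < t (i + 1) - t i) :
    Raise i (rowSegment t 0 k ++ w) (rowSegment t' 0 k ++ w) := by
  rw [rowSegment_split hi hik t, rowSegment_split hi hik t', hti, ht' _ (by omega),
    ht' _ (by omega), rowSegment_congr (t := t') (t' := t) fun j _ _ => ht' j (by omega),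
    rowSegment_congr (t := t') (t' := t) fun j _ _ => ht' j (by omega)]
  obtain ⟨b, hb⟩ : ∃ b, t (i + 1) - t i = b + 1 := ⟨t (i + 1) - t i - 1, by omega⟩
  have hb' : t (i + 1) - (t i + 1) = b := by omega
  have ha' : t i + 1 - t (i - 1) = (t i - t (i - 1)) + 1 := by omega
  rw [hb, hb', ha']
  refine ⟨rowSegment t 0 (i - 1) ++ List.replicate (t i - t (i - 1)) i,
    List.replicate b (i + 1) ++ (rowSegment t (i + 1) (k - i - 1) ++ w), ?_, ?_, ?_, ?_⟩
  · simp [List.replicate_succ]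
  · simp [List.replicate_succ']
  · simp [bracket_append, bracket_rowSegment_left (Nat.sub_lt hi one_pos), bracket_replicate_self,
      bracketMul]
  · simp only [bracket_append, bracket_rowSegment_right, bracket_replicate_succ, bracketMul]
    omega

lemma raise_tabWord (hT : RowMonotone k T) (hi : 1 ≤ i) (hik : i < k) {n r : ℕ} (hr : r < n)
    (hb : unmatchedAbove k i T r < T (i + 1) r - T i r)
    (hmax : ∀ j, r < j → j < n → T (i + 1) j - T i j ≤ unmatchedAbove k i T j) :
    Raise i (tabWord k n T) (tabWord k n (raiseAt i r T)) := by
  have hT' : RowMonotone k (raiseAt i r T) := hT.raiseAt (by omega)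
  induction n, hr using Nat.le_induction with
  | base =>
    rw [tabWord_succ hT, tabWord_succ hT',
      tabWord_congr (T := raiseAt i r T) (T' := T) fun s hs j => by simp [raiseAt]; omega]
    have := hT r (i - 1) (by omega)
    rw [Nat.sub_add_cancel hi] at this
    exact raise_rowSegment_append hi hik this (fun j hj => by simp [raiseAt, hj])
      (by simp [raiseAt]) hb
  | succ n hn ih =>
    rw [tabWord_succ hT, tabWord_succ hT',
      rowSegment_congr (t := fun j => raiseAt i r T j n) (t' := fun j => T j n)
        fun j _ _ => by simp [raiseAt]; omega]
    refine (ih fun j hj hjn => hmax j hj (by omega)).append_left ?_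
    rw [bracket_rowSegment hi hik]
    exact hmax n (by omega) (by omega)

end

lemma exists_last_or_forall_not (p : ℕ → Prop) (n : ℕ) :
    (∀ r, r < n → ¬ p r) ∨ ∃ r, r < n ∧ p r ∧ ∀ j, r < j → j < n → ¬ p j := by
  induction n with
  | zero => exact .inl fun r hr => absurd hr (by omega)
  | succ n ih =>
    by_cases hn : p n
    · exact .inr ⟨n, by omega, hn, fun j _ _ => by omega⟩
    · grind

lemma IsTableau.rowMonotone {k : ℕ} {T : ℕ → ℕ → ℕ} (hT : IsTableau k T) : RowMonotone k T :=
  fun r i hi => (hT.2 i hi).1 r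

lemma IsTableau.le_last {k i : ℕ} {T : ℕ → ℕ → ℕ} (hT : IsTableau k T) (hi : i ≤ k) (r : ℕ) :
    T i r ≤ T k r :=
  le_of_forall_le_succ (hT.rowMonotone r) hi

lemma IsTableau.rowMonotone_comp {k l : ℕ} {T : ℕ → ℕ → ℕ} (hT : IsTableau k T)
    (hl : ∀ r, T k r ≤ l) : RowMonotone k (comp k l T) := by
  intro r i hi
  have h1 := (hT.le_last (Nat.sub_le k i) (r - i)).trans (hl _)
  have h2 := (hT.2 (k - (i + 1)) (by omega)).2 (r - (i + 1))
  have h3 : k - (i + 1) + 1 = k - i := by omega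
  rw [h3] at h2
  simp only [comp]
  rcases lt_trichotomy r i with h | rfl | h
  · rw [if_pos h, if_pos (by omega)]
  · rw [if_neg (by omega), if_pos (by omega)]
    exact h1
  · rw [if_neg (by omega), if_neg (by omega)]
    convert h2 using 2
    omega

section

variable {k l i : ℕ} {T : ℕ → ℕ → ℕ}

lemma unmatchedAbove_comp_eq_zero (hT : IsTableau k T) (hl : ∀ r, T k r ≤ l) (hi : 1 ≤ i)
    (hik : i < k) {r : ℕ} (hr : r < k - i) : unmatchedAbove k (k - i) (comp k l T) r = 0 := by
  induction r with
  | zero => rfl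
  | succ r ih =>
    rw [unmatchedAbove_succ (hT.rowMonotone_comp hl) (by omega) (by omega), ih (by omega)]
    simp only [comp]
    rw [if_pos (by omega), if_pos (by omega)]
    omega

lemma unmatchedAbove_comp (hT : IsTableau k T) (hl : ∀ r, T k r ≤ l) (hi : 1 ≤ i)
    (hik : i < k) (r : ℕ) :
    unmatchedAbove k (k - i) (comp k l T) (r + (k - i)) + (T (i + 1) r - T i r) =
      unmatchedAbove k i T r + (comp k l T (k - i + 1) (r + (k - i)) -
        comp k l T (k - i) (r + (k - i))) := by
  have e1 : k - (k - i) = i := by omega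
  have e2 : k - (k - i + 1) = i - 1 := by omega
  have e3 : k - (k - i - 1) = i + 1 := by omega
  induction r with
  | zero =>
    have h1 := hT.rowMonotone 0 i hik
    have h2 := (hT.le_last (show i + 1 ≤ k by omega) 0).trans (hl 0)
    obtain ⟨m, hm⟩ : ∃ m, k - i = m + 1 := ⟨k - i - 1, by omega⟩
    have h0 := unmatchedAbove_comp_eq_zero hT hl hi hik (r := m) (by omega)
    have hs := unmatchedAbove_succ (hT.rowMonotone_comp hl) (i := k - i) (by omega) (by omega) m
    rw [zero_add, unmatchedAbove_zero]
    rw [h0, ← hm] at hs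
    rw [hs]
    simp only [comp, e1, e2, e3]
    rw [if_pos (by omega), if_neg (by omega), if_pos (by omega), if_pos (by omega),
      if_neg (by omega), show m - (k - i - 1) = 0 by omega]
    simp only [Nat.sub_self]
    omega
  | succ r ih =>
    have h1 := hT.rowMonotone r i hik
    have h2 := hT.rowMonotone (r + 1) i hik
    have h3 := hT.rowMonotone r (i - 1) (by omega)
    have h5 := (hT.2 i hik).2 r
    have h6 := (hT.2 (i - 1) (by omega)).2 r
    have h7 := hT.rowMonotone (r + 1) (i - 1) (by omega)
    rw [Nat.sub_add_cancel hi] at h3 h6 h7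
    rw [unmatchedAbove_succ hT.rowMonotone hi hik, show r + 1 + (k - i) = r + (k - i) + 1 by omega,
      unmatchedAbove_succ (hT.rowMonotone_comp hl) (by omega) (by omega)]
    have c1 : comp k l T (k - i) (r + (k - i)) = T i r := by simp [comp, e1]
    have c2 : comp k l T (k - i - 1) (r + (k - i)) = T (i + 1) (r + 1) := by
      simp only [comp, e3]
      rw [if_neg (by omega), show r + (k - i) - (k - i - 1) = r + 1 by omega]
    have c3 : comp k l T (k - i) (r + (k - i) + 1) = T i (r + 1) := by
      simp only [comp, e1]
      rw [if_neg (by omega), show r + (k - i) + 1 - (k - i) = r + 1 by omega]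
    have c4 : comp k l T (k - i + 1) (r + (k - i) + 1) = T (i - 1) r := by
      simp only [comp, e2]
      rw [if_neg (by omega), show r + (k - i) + 1 - (k - i + 1) = r by omega]
    rw [c1] at ih ⊢
    rw [c2, c3, c4]
    omega

lemma comp_raiseAt (hi : 1 ≤ i) (hik : i < k) (r : ℕ) :
    comp k l (raiseAt i r T) = raiseAt (k - i) (r + (k - i)) (comp k l T) := by
  funext j s
  simp only [comp, raiseAt]
  grind

lemma IsTableau.raiseAt (hT : IsTableau k T) (hi : 1 ≤ i) (hik : i < k) {r : ℕ}
    (hb : unmatchedAbove k i T r < T (i + 1) r - T i r) : IsTableau k (raiseAt i r T) := by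
  have hprev : ∀ s, r = s + 1 → T i r + 1 ≤ T (i - 1) s := by
    rintro s rfl
    rw [unmatchedAbove_succ hT.rowMonotone hi hik] at hb
    have h1 := (hT.2 i hik).2 s
    have h2 := hT.rowMonotone s (i - 1) (by omega)
    rw [Nat.sub_add_cancel hi] at h2
    omega
  constructor
  · intro j hj
    obtain ⟨h1, N, hN⟩ := hT.1 j hj
    refine ⟨fun s => ?_, max N (r + 1), fun s hs => ?_⟩
    · have h2 := h1 s
      have h3 := hprev s
      have h4 := hT.rowMonotone s (i - 1) (by omega)
      rw [Nat.sub_add_cancel hi] at h4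
      simp only [_root_.raiseAt]
      grind
    · simp only [_root_.raiseAt]
      rw [if_neg (by omega)]
      exact hN s (by omega)
  · intro j hj
    obtain ⟨h1, h2⟩ := hT.2 j hj
    refine ⟨fun s => hT.rowMonotone.raiseAt (by omega) s j hj, fun s => ?_⟩
    have h3 := hprev s
    have h4 := h2 s
    simp only [_root_.raiseAt]
    grind

end

/-- The words of a tableau with at most `l` columns and of its complement. -/
def ComplementaryWords (k l : ℕ) (w v : List ℕ) : Prop :=
  ∃ n T, IsTableau k T ∧ (∀ r, T k r ≤ l) ∧ (∀ r, n ≤ r → T k r = 0) ∧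
    w = tabWord k n T ∧ v = tabWord k (k + n) (comp k l T)

lemma ComplementaryWords.raise {k l : ℕ} {w v : List ℕ} (h : ComplementaryWords k l w v) {i : ℕ}
    (hi : 1 ≤ i) (hik : i < k) :
    ((bracket i w).2 = 0 ∧ (bracket (k - i) v).2 = 0) ∨
      ∃ w' v', Raise i w w' ∧ Raise (k - i) v v' ∧ ComplementaryWords k l w' v' := by
  obtain ⟨n, T, hT, hl, hn, rfl, rfl⟩ := h
  have hcomp := hT.rowMonotone_comp hl
  have hrow : ∀ j, (∀ r, j = r + (k - i) → r < n →
      T (i + 1) r - T i r ≤ unmatchedAbove k i T r) →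
      comp k l T (k - i + 1) j - comp k l T (k - i) j ≤
        unmatchedAbove k (k - i) (comp k l T) j := by
    intro j hj
    rcases lt_or_ge j (k - i) with hjk | hjk
    · simp only [comp]
      rw [if_pos (by omega), if_pos hjk]
      omega
    · obtain ⟨r, rfl⟩ : ∃ r, j = r + (k - i) := ⟨j - (k - i), by omega⟩
      have hu := unmatchedAbove_comp hT hl hi hik r
      have hr : T (i + 1) r - T i r ≤ unmatchedAbove k i T r := by
        rcases lt_or_ge r n with h | h
        · exact hj r rfl h
        · have := (hT.le_last (show i + 1 ≤ k by omega) r).trans_eq (hn r h)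
          omega
      omega
  rcases exists_last_or_forall_not
    (fun r => unmatchedAbove k i T r < T (i + 1) r - T i r) n with h | ⟨r, hr, hb, hmax⟩
  · simp only [not_lt] at h
    exact .inl ⟨bracket_tabWord_eq_zero hT.rowMonotone hi hik h,
      bracket_tabWord_eq_zero hcomp (by omega) (by omega)
        fun j _ => hrow j fun r _ hr => h r hr⟩
  · simp only [not_lt] at hmax
    refine .inr ⟨_, _, raise_tabWord hT.rowMonotone hi hik hr hb hmax,
      raise_tabWord hcomp (r := r + (k - i)) (by omega) (by omega) (by omega) ?_ ?_,
      n, raiseAt i r T, hT.raiseAt hi hik hb, ?_, ?_, rfl, by rw [comp_raiseAt hi hik]⟩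
    · have := unmatchedAbove_comp hT hl hi hik r
      omega
    · intro j hj _
      exact hrow j fun s hs hsn => hmax s (by omega) hsn
    · simpa [raiseAt, hik.ne'] using hl
    · simpa [raiseAt, hik.ne'] using hn

lemma count_rowSegment {i k : ℕ} (hi : 1 ≤ i) (hik : i ≤ k) (t : ℕ → ℕ) :
    (rowSegment t 0 k).count i = t i - t (i - 1) := by
  obtain ⟨m, rfl⟩ : ∃ m, i = m + 1 := ⟨i - 1, by omega⟩
  obtain ⟨p, rfl⟩ : ∃ p, k = m + (1 + p) := ⟨k - m - 1, by omega⟩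
  have h1 : (rowSegment t 0 m).count (m + 1) = 0 :=
    List.count_eq_zero.2 fun h => by have := mem_rowSegment h; omega
  have h2 : (rowSegment t (0 + m + 1) p).count (m + 1) = 0 :=
    List.count_eq_zero.2 fun h => by have := mem_rowSegment h; omega
  rw [rowSegment_add, rowSegment_add, rowSegment_one, List.count_append, List.count_append, h1, h2]
  simp

lemma count_tabWord {k i : ℕ} {T : ℕ → ℕ → ℕ} (hT : RowMonotone k T) (hi : 1 ≤ i) (hik : i ≤ k)
    (n : ℕ) :
    (tabWord k n T).count i + ∑ r ∈ Finset.range n, T (i - 1) r = ∑ r ∈ Finset.range n, T i r := by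
  induction n with
  | zero => simp [tabWord]
  | succ n ih =>
    have := hT n (i - 1) (by omega)
    rw [Nat.sub_add_cancel hi] at this
    rw [tabWord_succ hT, List.count_append, count_rowSegment hi hik, Finset.sum_range_succ,
      Finset.sum_range_succ, ← ih]
    omega

lemma sum_comp {k l n i : ℕ} {T : ℕ → ℕ → ℕ} (hT : IsTableau k T) (hn : ∀ r, n ≤ r → T k r = 0)
    (hik : i ≤ k) :
    ∑ r ∈ Finset.range (k + n), comp k l T i r = i * l + ∑ r ∈ Finset.range n, T (k - i) r := by
  have h1 : ∀ r ∈ Finset.range i, comp k l T i r = l := fun r hr => by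
    simp [comp, Finset.mem_range.1 hr]
  have h2 : ∀ r, comp k l T i (i + r) = T (k - i) r := fun r => by simp [comp]
  have h3 : ∀ r, T (k - i) (n + r) = 0 := fun r =>
    Nat.le_zero.1 ((hT.le_last (Nat.sub_le k i) (n + r)).trans_eq (hn _ (by omega)))
  rw [show k + n = i + (n + (k - i)) by omega, Finset.sum_range_add, Finset.sum_range_add,
    Finset.sum_congr rfl h1]
  simp [h2, h3]

lemma ComplementaryWords.count_add_count {k l : ℕ} {w v : List ℕ}
    (h : ComplementaryWords k l w v) {i : ℕ} (hi : 1 ≤ i) (hik : i ≤ k) :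
    v.count i + w.count (k + 1 - i) = l := by
  obtain ⟨n, T, hT, hl, hn, rfl, rfl⟩ := h
  have h1 := count_tabWord (hT.rowMonotone_comp hl) hi hik (k + n)
  have h2 := count_tabWord hT.rowMonotone (i := k + 1 - i) (by omega) (by omega) n
  rw [sum_comp hT hn hik, sum_comp hT hn (by omega)] at h1
  obtain ⟨m, rfl⟩ : ∃ m, i = m + 1 := ⟨i - 1, by omega⟩
  rw [show k + 1 - (m + 1) - 1 = k - (m + 1) by omega, show k + 1 - (m + 1) = k - m by omega] at h2
  rw [show k + 1 - (m + 1) = k - m by omega]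
  rw [Nat.add_sub_cancel, add_one_mul] at h1
  omega

/-- **Complementation preserves Knuth equivalence.**  Suppose `T` and `U` are skew
tableaux with at most `l` columns and entries from the alphabet `[k]` (contained in the
first `n`, resp. `m`, rows).  Two tableaux are Knuth-equivalent exactly when their
reading words are Knuth-equivalent.  Then `U` is Knuth-equivalent to `T` if and only if
`U^C` is Knuth-equivalent to `T^C`, both complements formed with parameters `k`, `l`. -/
theorem complement_knuth_equivalence (k l n m : ℕ) (T U : ℕ → ℕ → ℕ)
    (hT : IsTableau k T) (hU : IsTableau k U)
    (hTl : ∀ r, T k r ≤ l) (hUl : ∀ r, U k r ≤ l)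
    (hTn : ∀ r, n ≤ r → T k r = 0) (hUm : ∀ r, m ≤ r → U k r = 0) :
    KnuthEquiv (tabWord k n T) (tabWord k m U) ↔
      KnuthEquiv (tabWord k (k + n) (comp k l T)) (tabWord k (k + m) (comp k l U)) := by
  have hTT : ComplementaryWords k l _ _ := ⟨n, T, hT, hTl, hTn, rfl, rfl⟩
  have hUU : ComplementaryWords k l _ _ := ⟨m, U, hU, hUl, hUm, rfl, rfl⟩
  constructor
  · refine KnuthEquiv.transport (k := k) (l := l) (R := ComplementaryWords k l) ?_
      (fun _ _ h _ => h.count_add_count) (fun _ _ h _ => h.raise) hTT hUU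
    rintro _ _ ⟨n, T, hT, hl, -, -, rfl⟩ a ha
    exact mem_tabWord (hT.rowMonotone_comp hl) ha
  · refine KnuthEquiv.transport (k := k) (l := l) (R := fun w v => ComplementaryWords k l v w)
      ?_ ?_ ?_ hTT hUU
    · rintro _ _ ⟨n, T, hT, -, -, rfl, -⟩ a ha
      exact mem_tabWord hT.rowMonotone ha
    · intro w v h i hi hik
      have := h.count_add_count (i := k + 1 - i) (by omega) (by omega)
      rwa [show k + 1 - (k + 1 - i) = i by omega, add_comm] at this
    · intro w v h i hi hik
      have := h.raise (i := k - i) (by omega) (by omega)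
      rw [Nat.sub_sub_self hik.le] at this
      rcases this with h | ⟨w', v', h1, h2, h3⟩
      · exact .inl h.symm
      · exact .inr ⟨v', w', h2, h1, h3⟩
end

section
/- Let P: β⁰ ⋖ β¹ ⋖ ⋯ ⋖ β^k be a standard tableau whose shapes each have n nonnegative parts, and let b be the largest part of β^k. Prepend ∞ and append 0 to each β^i, regarding each as a stable shape, and write β⁰ = (∞, b₁, …, b_n, 0-appended). Set γ⁰ := (b, b₁, b₂, …, b_n, −∞) and let Q be the one-strip stable tableau β⁰/γ⁰. Put (T; U) := H(P; Q) and write T: γ⁰ ⋖ γ¹ ⋖ ⋯ ⋖ γ^k. Let S(P): α⁰ ⊆ α¹ ⊆ ⋯ ⊆ α^k be the result of Tesler's rightward shift game applied to P, and for each i set a_i := #{j < i : α^j = α^{j+1}}. Then for every i = 0, …, k, the stable shape γ^i equals (b + a_i, α^i₁, α^i₂, …, α^i_n, −∞). In particular, r(P) is the set of entries in the first row of T, and S(P) consists of the remaining rows of T. -/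
/-- The internal column insertion local rule `C(α; β, γ) = δ` (parts `1, …, m`). -/
def CRel (m : ℕ) (α β γ δ : ℕ → ℤ) : Prop :=
  ∃ d : ℕ → ℤ, d m = 0 ∧
    (∀ i, 2 ≤ i → i ≤ m →
      δ i = min (β i + γ i + d i - α i) (α (i - 1)) ∧
      d (i - 1) = max (β i + γ i + d i - α i - α (i - 1)) 0) ∧
    δ 1 = β 1 + γ 1 + d 1 - α 1

/-- The growth diagram relation for internal column insertion:
`C(P,Q) = (T,U)`, with `P` across the first row, `Q` down the first column, `T` the
last row and `U` the last column. -/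
def GrowC (m kP kQ : ℕ) (P Q T U : ℕ → ℕ → ℤ) : Prop :=
  ∃ G : ℕ → ℕ → ℕ → ℤ,
    (∀ j, j ≤ kP → G 0 j = P j) ∧
    (∀ i, i ≤ kQ → G i 0 = Q i) ∧
    (∀ i, i < kQ → ∀ j, j < kP →
      CRel m (G i j) (G i (j + 1)) (G (i + 1) j) (G (i + 1) (j + 1))) ∧
    (∀ j, j ≤ kP → G kQ j = T j) ∧
    (∀ i, i ≤ kQ → G i kP = U i)

/-- `b/a` is a single box lying in row `r` (parts `1, …, n`). -/
def CoverAtW (n : ℕ) (a b : ℕ → ℤ) (r : ℕ) : Prop :=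
  1 ≤ r ∧ r ≤ n ∧ b r = a r + 1 ∧
  ∀ s, 1 ≤ s → s ≤ n → s ≠ r → b s = a s

/-- Writing `c i = β i + d i - α i`, the local rule of internal insertion: `c` is the box carried
into row `i`, starting at the row `r` of `β/α`. -/
theorem CRel.exists_carry {n r : ℕ} {α β γ δ : ℕ → ℤ} (h : CRel (n + 1) α β γ δ)
    (hc : CoverAtW n α β r) (hlast : β (n + 1) = α (n + 1)) :
    ∃ c : ℕ → ℤ, c (n + 1) = 0 ∧ δ 1 = γ 1 + c 1 ∧
      (∀ i, 1 ≤ i → i ≤ n → δ (i + 1) = min (γ (i + 1) + c (i + 1)) (α i)) ∧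
      (∀ i, 1 ≤ i → i ≤ n → i ≠ r → c i = max (γ (i + 1) + c (i + 1) - α i) 0) ∧
      c r = 1 + max (γ (r + 1) + c (r + 1) - α r) 0 := by
  obtain ⟨d, hd, hstep, hone⟩ := h
  obtain ⟨hr1, hrn, hbox, hsame⟩ := hc
  refine ⟨fun i => β i + d i - α i, by simp [hd, hlast], by simp only; omega, ?_, ?_, ?_⟩
  · intro i h1 hn
    have := (hstep (i + 1) (by omega) (by omega)).1
    simp only [Nat.add_sub_cancel] at this ⊢
    omega
  · intro i h1 hn hir
    have := (hstep (i + 1) (by omega) (by omega)).2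
    have := hsame i h1 hn hir
    simp only [Nat.add_sub_cancel] at *
    omega
  · have := (hstep (r + 1) (by omega) (by omega)).2
    simp only [Nat.add_sub_cancel] at *
    omega

/-- Adding a box in row `r` to the first shape adds a box to the second shape one row below the
largest row `r' < r` in which `γ (r' + 1) < α r'`, or in the first row if there is none. -/
theorem CRel.shift {n r : ℕ} {α β γ δ : ℕ → ℤ} (h : CRel (n + 1) α β γ δ)
    (hc : CoverAtW n α β r) (hlast : β (n + 1) = α (n + 1))
    (hle : ∀ i, 1 ≤ i → i ≤ n → γ (i + 1) ≤ α i) :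
    ((∀ s, 1 ≤ s → s < r → ¬ γ (s + 1) < α s) →
      δ 1 = γ 1 + 1 ∧ ∀ i, 1 ≤ i → i ≤ n → δ (i + 1) = γ (i + 1)) ∧
    (∀ s, 1 ≤ s → s < r → γ (s + 1) < α s →
      (∀ t, s < t → t < r → ¬ γ (t + 1) < α t) →
      δ 1 = γ 1 ∧ CoverAtW n (fun i => γ (i + 1)) (fun i => δ (i + 1)) s) := by
  obtain ⟨c, hcn, hδ1, hδ, hcs, hcr⟩ := h.exists_carry hc hlast
  obtain ⟨hr1, hrn, -, -⟩ := hc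
  have above : ∀ s, r < s → s ≤ n + 1 → c s = 0 := by
    intro s hrs hsn
    induction hsn using Nat.decreasingInduction with
    | self => exact hcn
    | of_succ s hs ih =>
      have := hcs s (by omega) (by omega) (by omega)
      have := hle s (by omega) (by omega)
      have := ih (by omega)
      omega
  have at_r : c r = 1 := by
    have := above (r + 1) (by omega) (by omega)
    have := hle r hr1 hrn
    omega
  have carried : ∀ s, 1 ≤ s → s ≤ r → (∀ t, s ≤ t → t < r → ¬ γ (t + 1) < α t) → c s = 1 := by
    intro s h1 hsr
    induction hsr using Nat.decreasingInduction with
    | self => exact fun _ => at_r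
    | of_succ s hs ih =>
      intro hfull
      have := ih (by omega) (fun t ht => hfull t (by omega))
      have := hfull s le_rfl (by omega)
      have := hle s h1 (by omega)
      have := hcs s h1 (by omega) (by omega)
      omega
  constructor
  · intro hfull
    refine ⟨by rw [hδ1, carried 1 le_rfl hr1 fun t ht => hfull t (by omega)], fun i h1 hn => ?_⟩
    have := hδ i h1 hn
    have := hle i h1 hn
    by_cases hir : i < r
    · have := carried (i + 1) (by omega) (by omega) fun t ht => hfull t (by omega)
      have := hfull i h1 hir
      omega
    · have := above (i + 1) (by omega) (by omega)
      omega
  · intro s h1 hsr hlt hfull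
    have carried_succ : c (s + 1) = 1 :=
      carried (s + 1) (by omega) (by omega) fun t ht => hfull t (by omega)
    have below : ∀ t, 1 ≤ t → t ≤ s → c t = 0 := by
      intro t ht hts
      induction hts using Nat.decreasingInduction with
      | self =>
        have := hcs s h1 (by omega) (by omega)
        omega
      | of_succ t hts ih =>
        have := ih (by omega)
        have := hle t ht (by omega)
        have := hcs t ht (by omega) (by omega)
        omega
    refine ⟨by rw [hδ1, below 1 le_rfl h1, add_zero], h1, by omega, ?_, fun i hi hn his => ?_⟩
    · have := hδ s h1 (by omega)
      simp only
      omega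
    · have := hδ i hi hn
      have := hle i hi hn
      simp only
      rcases lt_or_gt_of_ne his with hlt' | hgt
      · have := below (i + 1) (by omega) (by omega)
        omega
      · by_cases hir : i < r
        · have := carried (i + 1) (by omega) (by omega) fun t ht => hfull t (by omega)
          have := hfull i hgt hir
          omega
        · have := above (i + 1) (by omega) (by omega)
          omega

/-- **Tesler's rightward shift game is computed by hopscotch.**  Let
`P : β⁰ ⋖ β¹ ⋖ ⋯ ⋖ βᵏ` be a standard tableau whose shapes each have `n` nonnegative
parts (indexed `1, …, n`), let `b` be the largest part of `βᵏ`; prepend `∞` and append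
`0` to each shape (so all shapes have the window of parts `1, …, n+1`, with
`(n+1)`-st part `0`), and let `Q` be the one-strip stable tableau `β⁰/γ⁰` with
`γ⁰ = (b, b₁, …, b_n, −∞)`.  Put `(T; U) := H(P; Q)`, i.e. `C(P, Q^S) = (T, U′)`
where `Q^S` is the ordinarization `(b₁, …, b_n, 0) ⊆ (b, b₁, …, b_n)` of the stable
complement of `Q`.  Let `S(P) : α⁰ ⊆ ⋯ ⊆ αᵏ` be the result of Tesler's rightward
shift game applied to `P` and `aᵢ := #{j < i : αʲ = αʲ⁺¹}`.  Then for every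
`i = 0, …, k` the stable shape `γⁱ` (the `i`-th shape of `T`) equals
`(b + aᵢ, αⁱ₁, …, αⁱ_n, −∞)`.  In particular `r(P)` is the set of entries in the first
row of `T` and `S(P)` consists of the remaining rows of `T`. -/
theorem tesler_shift_game_hopscotch (n k : ℕ) (hn : 1 ≤ n)
    (P A : ℕ → ℕ → ℤ) (a : ℕ → ℕ) (b : ℤ)
    (Q T U : ℕ → ℕ → ℤ)
    (hb : b = P k 1)
    -- the shapes of P: n nonnegative, weakly decreasing parts, with an appended 0
    (hdec : ∀ i, i ≤ k → ∀ j, 1 ≤ j → j < n → P i (j + 1) ≤ P i j)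
    (hpos : ∀ i, i ≤ k → ∀ j, 1 ≤ j → j ≤ n → 0 ≤ P i j)
    (hzero : ∀ i, i ≤ k → P i (n + 1) = 0)
    -- P is standard
    (hstd : ∀ i, i < k → ∃ r, CoverAtW n (P i) (P (i + 1)) r)
    -- A = S(P) is the result of Tesler's rightward shift game
    (hA0 : ∀ j, 1 ≤ j → j ≤ n → A 0 j = P 0 j)
    (hA : ∀ i, i < k → ∀ r, CoverAtW n (P i) (P (i + 1)) r →
      ((∀ r', 1 ≤ r' → r' < r → ¬ A i r' < P i r') →
        ∀ j, 1 ≤ j → j ≤ n → A (i + 1) j = A i j) ∧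
      (∀ r', 1 ≤ r' → r' < r → A i r' < P i r' →
        (∀ r'', r' < r'' → r'' < r → ¬ A i r'' < P i r'') →
        CoverAtW n (A i) (A (i + 1)) r'))
    -- a i = #{j < i : αʲ = αʲ⁺¹}
    (ha0 : a 0 = 0)
    (ha : ∀ i, i < k →
      (a (i + 1) = a i + 1 ∧ ∀ r, 1 ≤ r → r ≤ n → A (i + 1) r = A i r) ∨
      (a (i + 1) = a i ∧ ¬ ∀ r, 1 ≤ r → r ≤ n → A (i + 1) r = A i r))
    -- Q^S, the ordinarization of the stable complement of Q
    (hQ0 : ∀ j, Q 0 j = P 0 j)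
    (hQ1 : ∀ j, Q 1 j = if j = 1 then b else P 0 (j - 1))
    -- (T, U) = C(P, Q^S), i.e. (T; U^S) = H(P; Q)
    (hgrow : GrowC (n + 1) k 1 P Q T U) :
    (∀ i, i ≤ k →
      T i 1 = b + (a i : ℤ) ∧ ∀ r, 1 ≤ r → r ≤ n → T i (r + 1) = A i r) ∧
    (∀ i, i < k →
      ((∀ r, 1 ≤ r → r ≤ n → A (i + 1) r = A i r) ↔ T (i + 1) 1 = T i 1 + 1)) := by
  obtain ⟨G, hG0, hGQ, hG, hGT, -⟩ := hgrow
  have hT0 : ∀ j, T 0 j = Q 1 j := fun j => by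
    rw [← hGT 0 (Nat.zero_le k), hGQ 1 le_rfl]
  have hT : ∀ i, i < k → CRel (n + 1) (P i) (P (i + 1)) (T i) (T (i + 1)) := fun i hi => by
    have := hG 0 one_pos i hi
    rwa [hG0 i hi.le, hG0 (i + 1) hi, hGT i hi.le, hGT (i + 1) hi] at this
  have main : ∀ i, i ≤ k → (T i 1 = b + (a i : ℤ) ∧ ∀ r, 1 ≤ r → r ≤ n → T i (r + 1) = A i r) ∧
      ∀ r, 1 ≤ r → r ≤ n → A i r ≤ P i r := by
    intro i
    induction i with
    | zero =>
      intro _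
      refine ⟨⟨by simp [hT0, hQ1, ha0], fun r h1 hr => ?_⟩, fun r h1 hr => (hA0 r h1 hr).le⟩
      rw [hT0, hQ1, if_neg (by omega), Nat.add_sub_cancel, hA0 r h1 hr]
    | succ i ih =>
      intro hi
      obtain ⟨⟨hT1, hTA⟩, hAP⟩ := ih (by omega)
      obtain ⟨r, hr⟩ := hstd i hi
      obtain ⟨hfix, hmove⟩ := hA i hi r hr
      obtain ⟨hshift, hshift'⟩ := (hT i hi).shift hr
        ((hzero (i + 1) hi).trans (hzero i (by omega)).symm)
        (fun j h1 hj => (hTA j h1 hj).trans_le (hAP j h1 hj))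
      obtain ⟨hr1, hrn, hbox, hsame⟩ := hr
      have hPP : ∀ j, 1 ≤ j → j ≤ n → P i j ≤ P (i + 1) j := by
        intro j h1 hj
        by_cases hjr : j = r
        · subst hjr; omega
        · exact (hsame j h1 hj hjr).ge
      by_cases hfull : ∀ s, 1 ≤ s → s < r → ¬ A i s < P i s
      · have hAeq := hfix hfull
        obtain ⟨h1, h2⟩ := hshift fun s hs hsr => by
          rw [hTA s hs (by omega)]
          exact hfull s hs hsr
        refine ⟨⟨?_, fun j hj hjn => by rw [h2 j hj hjn, hTA j hj hjn, hAeq j hj hjn]⟩,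
          fun j hj hjn => (hAeq j hj hjn).trans_le ((hAP j hj hjn).trans (hPP j hj hjn))⟩
        rcases ha i hi with ⟨h, -⟩ | ⟨-, h⟩
        · rw [h1, hT1, h]; push_cast; ring
        · exact absurd hAeq h
      · have hne : ((Finset.range r).filter fun s => 1 ≤ s ∧ A i s < P i s).Nonempty := by
          push Not at hfull
          obtain ⟨s, hs, hsr, hlt⟩ := hfull
          exact ⟨s, by simp [hs, hsr, hlt]⟩
        obtain ⟨s, hsmem, hsmax⟩ := Finset.exists_max_image _ id hne
        simp only [Finset.mem_filter, Finset.mem_range, id] at hsmem hsmax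
        obtain ⟨hsr, hs, hlt⟩ := hsmem
        have hmax : ∀ t, s < t → t < r → ¬ A i t < P i t := fun t hst htr ht =>
          absurd (hsmax t ⟨htr, by omega, ht⟩) (by omega)
        obtain ⟨-, hsn, hAs, hAne⟩ := hmove s hs hsr hlt hmax
        obtain ⟨h1, -, -, h3, h4⟩ := hshift' s hs hsr (by rwa [hTA s hs (by omega)])
          fun t hst htr => by
            rw [hTA t (by omega) (by omega)]
            exact hmax t hst htr
        simp only at h3 h4
        refine ⟨⟨?_, fun j hj hjn => ?_⟩, fun j hj hjn => ?_⟩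
        · rcases ha i hi with ⟨-, h⟩ | ⟨h, -⟩
          · have := h s hs hsn
            omega
          · rw [h1, hT1, h]
        · by_cases hjs : j = s
          · subst hjs; rw [h3, hTA j hj hjn, hAs]
          · rw [h4 j hj hjn hjs, hTA j hj hjn, hAne j hj hjn hjs]
        · have := hPP j hj hjn
          by_cases hjs : j = s
          · subst hjs; omega
          · exact (hAne j hj hjn hjs).trans_le ((hAP j hj hjn).trans this)
  refine ⟨fun i hi => (main i hi).1, fun i hi => ?_⟩
  rw [(main i hi.le).1.1, (main (i + 1) hi).1.1]
  rcases ha i hi with ⟨h, h'⟩ | ⟨h, h'⟩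
  · exact iff_of_true h' (by rw [h]; push_cast; ring)
  · exact iff_of_false h' (by rw [h]; omega)
end
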